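/- arXiv:quant-ph/0611289 — 3 statements merged into one kernel-verified Lean document; each statement's English description precedes it below -/
import Mathlib

section
/- Let ρ and σ be faithful density operators on a finite-dimensional complex Hilbert space, and let Ψ(b) := max_{s∈ℝ}(b·s − φ(s+1)) with φ(s) := log Tr[ρ^{1−s}σ^{s}]. Then for every b with −D(ρ‖σ) < b < D(σ‖ρ) and every sequence of tests {T_n} (0 ≤ T_n ≤ I on the n-fold tensor power space), with α_n[T_n] := Tr[ρ^{⊗n}(I − T_n)] and β_n[T_n] := Tr[σ^{⊗n} T_n], one has −b − Ψ(b) ≤ max{ liminf_{n→∞} (1/n)·log α_n[T_n], −b + limsup_{n→∞} (1/n)·log β_n[T_n] }. -/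
open scoped Matrix ComplexOrder
open Filter

noncomputable section

/-- Real power of a matrix, taken via the spectral decomposition when the matrix is
Hermitian (with the convention `0 ^ t` given by `Real.rpow`), and `0` otherwise. -/
def mpow {n : Type*} [Fintype n] [DecidableEq n] (A : Matrix n n ℂ) (t : ℝ) : Matrix n n ℂ :=
  if h : A.IsHermitian then
    (Matrix.IsHermitian.eigenvectorUnitary h : Matrix n n ℂ) *
      Matrix.diagonal (fun i => ((h.eigenvalues i ^ t : ℝ) : ℂ)) *
      (star (Matrix.IsHermitian.eigenvectorUnitary h : Matrix n n ℂ))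
  else 0

/-- Logarithm of a matrix via the spectral decomposition (Hermitian case), `0` otherwise. -/
def mlog {n : Type*} [Fintype n] [DecidableEq n] (A : Matrix n n ℂ) : Matrix n n ℂ :=
  if h : A.IsHermitian then
    (Matrix.IsHermitian.eigenvectorUnitary h : Matrix n n ℂ) *
      Matrix.diagonal (fun i => ((Real.log (h.eigenvalues i) : ℝ) : ℂ)) *
      (star (Matrix.IsHermitian.eigenvectorUnitary h : Matrix n n ℂ))
  else 0

/-- Exponential of a matrix via the spectral decomposition (Hermitian case), `0` otherwise. -/
def mexp {n : Type*} [Fintype n] [DecidableEq n] (A : Matrix n n ℂ) : Matrix n n ℂ :=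
  if h : A.IsHermitian then
    (Matrix.IsHermitian.eigenvectorUnitary h : Matrix n n ℂ) *
      Matrix.diagonal (fun i => ((Real.exp (h.eigenvalues i) : ℝ) : ℂ)) *
      (star (Matrix.IsHermitian.eigenvectorUnitary h : Matrix n n ℂ))
  else 0

/-- The orthogonal projection onto the span of the eigenvectors of a Hermitian matrix
corresponding to positive eigenvalues, denoted `{A > 0}` in the paper; `0` otherwise. -/
def posProj {n : Type*} [Fintype n] [DecidableEq n] (A : Matrix n n ℂ) : Matrix n n ℂ :=
  if h : A.IsHermitian then
    (Matrix.IsHermitian.eigenvectorUnitary h : Matrix n n ℂ) *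
      Matrix.diagonal (fun i => if 0 < h.eigenvalues i then (1 : ℂ) else 0) *
      (star (Matrix.IsHermitian.eigenvectorUnitary h : Matrix n n ℂ))
  else 0

/-- The `n`-fold tensor (Kronecker) power `ρ^{⊗n}`, as a matrix indexed by `Fin n → Fin d`. -/
def tensorPow {d : ℕ} (ρ : Matrix (Fin d) (Fin d) ℂ) (n : ℕ) :
    Matrix (Fin n → Fin d) (Fin n → Fin d) ℂ :=
  fun v w => ∏ t, ρ (v t) (w t)

/-- Quantum relative entropy `D(ρ‖σ) = Tr[ρ(log ρ − log σ)]`. -/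
def qRelEnt {d : ℕ} (ρ σ : Matrix (Fin d) (Fin d) ℂ) : ℝ :=
  ((ρ * (mlog ρ - mlog σ)).trace).re

/-- `φ(s | ρ‖σ) = log Tr[ρ^{1−s} σ^{s}]`. -/
def qphi {d : ℕ} (ρ σ : Matrix (Fin d) (Fin d) ℂ) (s : ℝ) : ℝ :=
  Real.log (((mpow ρ (1 - s)) * (mpow σ s)).trace.re)

lemma lb_moments {K : Type*} [Fintype K] (r y : K → ℝ) (h1 : ∑ k, r k = 1)
    (h0 : ∑ k, r k * y k = 0) (n : ℕ) :
    (∑ k : Fin n → K, ∏ t, r (k t)) = 1 ∧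
    (∑ k : Fin n → K, (∏ t, r (k t)) * ∑ t, y (k t)) = 0 ∧
    (∑ k : Fin n → K, (∏ t, r (k t)) * (∑ t, y (k t)) ^ 2) = n * ∑ k, r k * y k ^ 2 := by
  induction n with
  | zero => simp
  | succ n ih =>
    obtain ⟨i1, i2, i3⟩ := ih
    have key : ∀ f : (Fin (n+1) → K) → ℝ,
        ∑ k, f k = ∑ a : K, ∑ k : Fin n → K, f (Fin.cons a k) := by
      intro f
      rw [← Fintype.sum_prod_type']
      exact (Fintype.sum_equiv (Fin.consEquiv (fun _ => K)) _ _ (fun x => rfl)).symm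
    refine ⟨?_, ?_, ?_⟩
    · rw [key]
      simp only [Fin.prod_univ_succ, Fin.cons_zero, Fin.cons_succ, ← Finset.mul_sum, i1, h1, mul_one]
    · rw [key]
      simp only [Fin.prod_univ_succ, Fin.sum_univ_succ, Fin.cons_zero, Fin.cons_succ]
      have : ∀ a : K, ∑ k : Fin n → K, (r a * ∏ t, r (k t)) * (y a + ∑ t, y (k t))
          = r a * y a := by
        intro a
        have : ∀ k : Fin n → K, (r a * ∏ t, r (k t)) * (y a + ∑ t, y (k t)) =
          (r a * y a) * ∏ t, r (k t) + r a * ((∏ t, r (k t)) * ∑ t, y (k t)) := by intro k; ring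
        simp only [this, Finset.sum_add_distrib, ← Finset.mul_sum, i1, i2]; ring
      simp only [this, h0]
    · rw [key]
      simp only [Fin.prod_univ_succ, Fin.sum_univ_succ, Fin.cons_zero, Fin.cons_succ]
      have : ∀ a : K, ∑ k : Fin n → K, (r a * ∏ t, r (k t)) * (y a + ∑ t, y (k t)) ^ 2
          = r a * y a ^ 2 + r a * (n * ∑ k, r k * y k ^ 2) := by
        intro a
        have : ∀ k : Fin n → K, (r a * ∏ t, r (k t)) * (y a + ∑ t, y (k t)) ^ 2 =
          (r a * y a ^ 2) * ∏ t, r (k t) + (2 * r a * y a) * ((∏ t, r (k t)) * ∑ t, y (k t))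
          + r a * ((∏ t, r (k t)) * (∑ t, y (k t)) ^ 2) := by intro k; ring
        simp only [this, Finset.sum_add_distrib, ← Finset.mul_sum, i1, i2, i3]; ring
      simp only [this, Finset.sum_add_distrib, ← Finset.sum_mul, h1]
      push_cast; ring

/-- Jensen's inequality for the exponential (finite sums). -/
lemma lb_jensen {K : Type*} [Fintype K] (r x : K → ℝ) (hr : ∀ k, 0 ≤ r k) (h1 : ∑ k, r k = 1) :
    Real.exp (∑ k, r k * x k) ≤ ∑ k, r k * Real.exp (x k) := by
  have := convexOn_exp.map_sum_le (t := Finset.univ) (w := r) (p := x) (fun i _ => hr i) h1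
    (fun _ _ => Set.mem_univ _)
  simpa using this

lemma lb_expabs {K : Type*} [Fintype K] (r y : K → ℝ) (hr : ∀ k, 0 ≤ r k) (h1 : ∑ k, r k = 1)
    (h0 : ∑ k, r k * y k = 0) (n : ℕ) (hn : 1 ≤ n) :
    Real.exp (-(√n * ((∑ k, r k * y k ^ 2) + 1) / 2)) ≤
    ∑ k : Fin n → K, (∏ t, r (k t)) * Real.exp (-|∑ t, y (k t)|) := by
  obtain ⟨m1, m2, m3⟩ := lb_moments r y h1 h0 n
  have hq : 0 < √(n:ℝ) := Real.sqrt_pos.2 (by exact_mod_cast hn)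
  have hqq : √(n:ℝ) * √(n:ℝ) = n := Real.mul_self_sqrt (by positivity)
  set q := √(n:ℝ) with hqdef
  calc Real.exp (-(q * ((∑ k, r k * y k ^ 2) + 1) / 2))
      = Real.exp (∑ k : Fin n → K, (∏ t, r (k t)) *
          (-((∑ t, y (k t)) ^ 2 * (1 / (2 * q))  + q / 2))) := by
        congr 1
        have : ∀ k : Fin n → K, (∏ t, r (k t)) * (-((∑ t, y (k t)) ^ 2 * (1 / (2 * q))  + q / 2))
          = (-(1/(2*q))) * ((∏ t, r (k t)) * (∑ t, y (k t)) ^ 2) + (-(q/2)) * (∏ t, r (k t)) := by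
          intro k; ring
        simp only [this, Finset.sum_add_distrib, ← Finset.mul_sum, m1, m3, ← hqq]
        field_simp
        ring
    _ ≤ ∑ k : Fin n → K, (∏ t, r (k t)) *
          Real.exp (-((∑ t, y (k t)) ^ 2 * (1 / (2 * q))  + q / 2)) :=
        lb_jensen _ _ (fun k => Finset.prod_nonneg fun t _ => hr _) m1
    _ ≤ _ := by
        refine Finset.sum_le_sum fun k _ => ?_
        refine mul_le_mul_of_nonneg_left ?_ (Finset.prod_nonneg fun t _ => hr _)
        refine Real.exp_le_exp.2 (neg_le_neg ?_)
        have h := sq_nonneg (|∑ t, y (k t)| - q)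
        rw [← sq_abs (∑ t, y (k t))]
        set u := |∑ t, y (k t)|
        have : u ^ 2 * (1 / (2 * q)) + q / 2 - u = (u - q) ^ 2 / (2 * q) := by
          field_simp; ring
        have h2 : 0 ≤ (u - q) ^ 2 / (2 * q) := by positivity
        linarith

lemma lb_classical {K : Type*} [Fintype K] (o l m : K → ℝ) (ho : ∀ k, 0 ≤ o k)
    (hl : ∀ k, 0 < l k) (hm : ∀ k, 0 < m k) (b s Z : ℝ) (hs0 : 0 ≤ s) (hs1 : s ≤ 1)
    (hZ : Z = ∑ k, o k * (l k ^ (1 - s) * m k ^ s)) (hZ0 : 0 < Z)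
    (hF : ∑ k, o k * (l k ^ (1 - s) * m k ^ s) * (Real.log (m k) - Real.log (l k) - b) = 0) :
    ∃ V : ℝ, ∀ n : ℕ, 1 ≤ n →
      Real.exp (n * (Real.log Z - s * b)) * Real.exp (-(√n * (V + 1) / 2)) ≤
      ∑ k : Fin n → K, min (∏ t, l (k t)) (Real.exp (-(n * b)) * ∏ t, m (k t)) *
        ∏ t, o (k t) := by
  set r : K → ℝ := fun k => o k * (l k ^ (1 - s) * m k ^ s) / Z with hr
  set y : K → ℝ := fun k => Real.log (m k) - Real.log (l k) - b with hy
  have hr0 : ∀ k, 0 ≤ r k := fun k => div_nonneg (mul_nonneg (ho k)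
    (mul_nonneg (Real.rpow_nonneg (hl k).le _) (Real.rpow_nonneg (hm k).le _))) hZ0.le
  have hr1 : ∑ k, r k = 1 := by
    simp only [hr, ← Finset.sum_div, ← hZ]; exact div_self hZ0.ne'
  have hy0 : ∑ k, r k * y k = 0 := by
    have : ∀ k, r k * y k = o k * (l k ^ (1 - s) * m k ^ s) * (Real.log (m k) - Real.log (l k) - b) / Z := by
      intro k; simp only [hr, hy]; ring
    simp only [this, ← Finset.sum_div, hF, zero_div]
  refine ⟨∑ k, r k * y k ^ 2, fun n hn => ?_⟩
  refine (mul_le_mul_of_nonneg_left (lb_expabs r y hr0 hr1 hy0 n hn) (Real.exp_pos _).le).trans ?_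
  rw [Finset.mul_sum]
  refine Finset.sum_le_sum fun k _ => ?_
  have hrk : ∀ k, r k = o k * (l k * Real.exp (s * y k) * Real.exp (s * b - Real.log Z)) := by
    intro k
    have : l k ^ (1 - s) * m k ^ s / Z =
      l k * Real.exp (s * y k) * Real.exp (s * b - Real.log Z) := by
      rw [Real.rpow_def_of_pos (hl k), Real.rpow_def_of_pos (hm k)]
      conv_rhs => rw [← Real.exp_log (hl k)]
      conv_lhs => rw [← Real.exp_log hZ0]
      rw [← Real.exp_add, ← Real.exp_sub, ← Real.exp_add, ← Real.exp_add]
      congr 1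
      simp [hy, Real.exp_log (hl k), Real.exp_log hZ0]; ring
    rw [← this]; simp only [hr, mul_div_assoc]
  have hprod : ∏ t, r (k t) = (∏ t, o (k t)) * ((∏ t, l (k t)) * Real.exp (s * ∑ t, y (k t))
      * Real.exp (-(n * (Real.log Z - s * b)))) := by
    simp only [hrk, Finset.prod_mul_distrib, ← Real.exp_sum, Finset.mul_sum]
    congr 3
    simp; ring
  set u := ∑ t, y (k t) with hu
  have hmprod : Real.exp (-(n * b)) * ∏ t, m (k t) = (∏ t, l (k t)) * Real.exp u := by
    have : ∀ k, m k = l k * Real.exp (y k) * Real.exp b := by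
      intro k
      simp only [hy, Real.exp_sub, Real.exp_log (hl k), Real.exp_log (hm k)]
      have := (hl k).ne'
      field_simp
    simp only [this, Finset.prod_mul_distrib, ← Real.exp_sum]
    simp only [Finset.sum_const, Finset.card_univ, Fintype.card_fin, nsmul_eq_mul, Real.exp_neg]
    field_simp
    rfl
  rw [hprod, hmprod]
  have hL : 0 < ∏ t, l (k t) := Finset.prod_pos fun t _ => hl _
  have hO : 0 ≤ ∏ t, o (k t) := Finset.prod_nonneg fun t _ => ho _
  set L := ∏ t, l (k t)
  set O := ∏ t, o (k t)
  have e1 : Real.exp (n * (Real.log Z - s * b)) * (O * (L * Real.exp (s * u) *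
     Real.exp (-(n * (Real.log Z - s * b)))) * Real.exp (-|u|)) =
     (L * Real.exp (s * u - |u|)) * O := by
    rw [Real.exp_sub, Real.exp_neg, Real.exp_neg]; field_simp
  rw [e1]
  refine mul_le_mul_of_nonneg_right (le_min ?_ ?_) hO
  · have : s * u - |u| ≤ 0 := by
      rcases abs_cases u with ⟨h, h'⟩ | ⟨h, h'⟩ <;> rw [h] <;> nlinarith
    nlinarith [Real.exp_le_one_iff.2 this]
  · refine mul_le_mul_of_nonneg_left (Real.exp_le_exp.2 ?_) hL.le
    rcases abs_cases u with ⟨h, h'⟩ | ⟨h, h'⟩ <;> rw [h] <;> nlinarith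

/-- Final asymptotic argument. -/
lemma lb_final (α β : ℕ → ℝ) (L b c : ℝ) (hL : L ≤ 0) (hLb : L + b ≤ 0)
    (h : ∀ n : ℕ, 1 ≤ n → Real.exp (n * L) * Real.exp (-(√n * c)) ≤
      2 * (α n + Real.exp (-(n * b)) * β n)) :
    L ≤ max (liminf (fun n : ℕ => (1 / (n : ℝ)) * Real.log (α n)) atTop)
      (-b + limsup (fun n : ℕ => (1 / (n : ℝ)) * Real.log (β n)) atTop) := by
  by_contra hcon
  rw [not_le, max_lt_iff] at hcon
  obtain ⟨hA, hB⟩ := hcon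
  obtain ⟨M, hM1, hM2⟩ := exists_between (max_lt hA hB)
  rw [max_lt_iff] at hM1
  obtain ⟨hA1, hB1⟩ := hM1
  have hβ : ∀ᶠ n : ℕ in atTop, (1 / (n : ℝ)) * Real.log (β n) ≤ M + b := by
    rw [limsup_eq] at hB1 hB
    by_cases hne : {a | ∀ᶠ n : ℕ in atTop, (1 / (n : ℝ)) * Real.log (β n) ≤ a}.Nonempty
    · obtain ⟨a, ha, hab⟩ := exists_lt_of_csInf_lt hne (show _ < M + b by linarith)
      exact ha.mono fun n hn => hn.trans hab.le
    · rw [Set.not_nonempty_iff_eq_empty.1 hne, Real.sInf_empty] at hB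
      linarith
  have hlim : ∀ᶠ n : ℕ in atTop, Real.log 4 + √n * c ≤ n * (L - M) := by
    have hs : Tendsto (fun n : ℕ => √(n:ℝ)) atTop atTop :=
      Real.tendsto_sqrt_atTop.comp tendsto_natCast_atTop_atTop
    have hpos : 0 < L - M := by linarith
    filter_upwards [hs.eventually_ge_atTop ((Real.log 4 + |c|) / (L - M)),
      hs.eventually_ge_atTop 1] with n h1 h2
    rw [div_le_iff₀ hpos] at h1
    have hqq : √(n:ℝ) * √(n:ℝ) = n := Real.mul_self_sqrt (by positivity)
    have h4 : 0 ≤ Real.log 4 := Real.log_nonneg (by norm_num)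
    have := le_abs_self c
    have h5 : √(n:ℝ) * (Real.log 4 + |c|) ≤ √n * (√n * (L - M)) :=
      mul_le_mul_of_nonneg_left h1 (by positivity)
    rw [← mul_assoc, hqq] at h5
    nlinarith
  have hα : ∀ᶠ n : ℕ in atTop, M ≤ (1 / (n : ℝ)) * Real.log (α n) := by
    filter_upwards [hβ, hlim, eventually_ge_atTop 1] with n h1 h2 hn
    have hn0 : (0:ℝ) < n := by exact_mod_cast hn
    have h3 : Real.log (β n) ≤ n * (M + b) := by
      rw [one_div, inv_mul_le_iff₀ hn0] at h1; exact h1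
    have h4 : Real.exp (-(n * b)) * β n ≤ Real.exp (n * M) := by
      calc _ ≤ Real.exp (-(n * b)) * Real.exp (n * (M + b)) :=
            mul_le_mul_of_nonneg_left ((Real.le_exp_log _).trans (Real.exp_le_exp.2 h3))
              (Real.exp_pos _).le
        _ = _ := by rw [← Real.exp_add]; congr 1; ring
    have h5 : 4 * Real.exp (n * M) ≤ Real.exp (n * L) * Real.exp (-(√n * c)) := by
      have : (4:ℝ) = Real.exp (Real.log 4) := (Real.exp_log (by norm_num)).symm
      rw [this, ← Real.exp_add, ← Real.exp_add]
      exact Real.exp_le_exp.2 (by linarith)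
    have h6 : Real.exp (n * M) ≤ α n := by linarith [h n hn]
    have h7 : n * M ≤ Real.log (α n) := (Real.le_log_iff_exp_le ((Real.exp_pos _).trans_le h6)).2 h6
    rw [one_div, le_inv_mul_iff₀ hn0]; exact h7
  rw [liminf_eq] at hA1 hA
  by_cases hbd : BddAbove {a | ∀ᶠ n : ℕ in atTop, a ≤ (1 / (n : ℝ)) * Real.log (α n)}
  · have := le_csSup hbd hα
    linarith
  · rw [Real.sSup_of_not_bddAbove hbd] at hA
    linarith

lemma lb_star_mul_self {N : Type*} [Fintype N] [DecidableEq N] (A : Matrix N N ℂ) (i : N) :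
    ((A * star A) i i).re = ∑ j, ‖A i j‖ ^ 2 := by
  simp only [Matrix.mul_apply, Matrix.star_apply, Complex.re_sum]
  refine Finset.sum_congr rfl fun j _ => ?_
  rw [Complex.star_def, Complex.mul_conj, Complex.ofReal_re, Complex.normSq_eq_norm_sq]

lemma lb_trace_conj {N : Type*} [Fintype N] [DecidableEq N] (U M : Matrix N N ℂ) (a : N → ℝ) :
    ((U * Matrix.diagonal (fun i => (a i : ℂ)) * star U * M).trace).re =
      ∑ i, a i * ((star U * M * U) i i).re := by
  have : (U * Matrix.diagonal (fun i => (a i : ℂ)) * star U * M).trace =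
      (Matrix.diagonal (fun i => (a i : ℂ)) * (star U * M * U)).trace := by
    rw [mul_assoc, mul_assoc, Matrix.trace_mul_comm]; simp only [mul_assoc]
  rw [this, Matrix.trace, Complex.re_sum]
  refine Finset.sum_congr rfl fun i _ => ?_
  rw [Matrix.diag_apply, Matrix.diagonal_mul, Complex.re_ofReal_mul]

lemma lb_trace_two {N : Type*} [Fintype N] [DecidableEq N] (U V : Matrix N N ℂ) (a c : N → ℝ) :
    ((U * Matrix.diagonal (fun i => (a i : ℂ)) * star U *
      (V * Matrix.diagonal (fun i => (c i : ℂ)) * star V)).trace).re =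
      ∑ k : N × N, ‖(star U * V) k.1 k.2‖ ^ 2 * (a k.1 * c k.2) := by
  rw [lb_trace_conj, Fintype.sum_prod_type]
  refine Finset.sum_congr rfl fun i _ => ?_
  have : star U * (V * Matrix.diagonal (fun i => (c i : ℂ)) * star V) * U =
      (star U * V) * Matrix.diagonal (fun i => (c i : ℂ)) * star (star U * V) := by
    rw [star_mul, star_star]; simp only [mul_assoc]
  rw [this, Matrix.mul_apply, Complex.re_sum, Finset.mul_sum]
  refine Finset.sum_congr rfl fun j _ => ?_
  rw [Matrix.mul_diagonal, Matrix.star_apply, mul_right_comm, Complex.star_def, Complex.mul_conj,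
    ← Complex.ofReal_mul, Complex.ofReal_re, Complex.normSq_eq_norm_sq]
  ring

lemma lb_half {N : Type*} [Fintype N] [DecidableEq N] (U V T : Matrix N N ℂ)
    (hV : V * star V = 1) (a : N → ℝ) (ha : ∀ i, 0 ≤ a i)
    (h0 : T.PosSemidef) (h1 : (1 - T).PosSemidef) :
    ∑ i, a i * ∑ j, ‖(star U * T * V) i j‖ ^ 2 ≤
      ((U * Matrix.diagonal (fun i => (a i : ℂ)) * star U * T).trace).re := by
  have hTs : Tᴴ = T := h0.1
  have hTs' : (1 - T)ᴴ = 1 - T := h1.1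
  have hp : (T - T * T).PosSemidef := by
    have e : T - T * T = Tᴴ * (1 - T) * T + (1 - T)ᴴ * T * (1 - T) := by
      rw [hTs, hTs']; noncomm_ring
    rw [e]
    exact (h1.conjTranspose_mul_mul_same T).add (h0.conjTranspose_mul_mul_same (1 - T))
  rw [lb_trace_conj]
  refine Finset.sum_le_sum fun i _ => mul_le_mul_of_nonneg_left ?_ (ha i)
  rw [← lb_star_mul_self]
  have e2 : star U * T * V * star (star U * T * V) = star U * (T * T) * U := by
    rw [star_mul, star_mul, star_star, Matrix.star_eq_conjTranspose T, hTs]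
    calc _ = star U * T * (V * star V) * (T * U) := by simp only [mul_assoc]
      _ = _ := by rw [hV]; simp only [mul_assoc, mul_one, one_mul]
  rw [e2]
  have h3 := (hp.conjTranspose_mul_mul_same U).diag_nonneg (i := i)
  have e3 : Uᴴ * (T - T * T) * U = star U * T * U - star U * (T * T) * U := by
    rw [Matrix.star_eq_conjTranspose]; noncomm_ring
  rw [e3, Matrix.sub_apply, Complex.le_def] at h3
  have := h3.1
  simp only [Complex.sub_re, Complex.zero_re] at this
  linarith

lemma lb_test {N : Type*} [Fintype N] [DecidableEq N] (U V T : Matrix N N ℂ)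
    (hU : U * star U = 1) (hV : V * star V = 1) (a c : N → ℝ) (ha : ∀ i, 0 ≤ a i)
    (hc : ∀ i, 0 ≤ c i) (h0 : T.PosSemidef) (h1 : (1 - T).PosSemidef) (q : ℝ) (hq : 0 ≤ q) :
    ∑ k : N × N, min (a k.1) (q * c k.2) * ‖(star U * V) k.1 k.2‖ ^ 2 ≤
      2 * (((U * Matrix.diagonal (fun i => (a i : ℂ)) * star U * (1 - T)).trace).re +
       q * ((V * Matrix.diagonal (fun i => (c i : ℂ)) * star V * T).trace).re) := by
  have A := lb_half U V (1 - T) hV a ha h1 (by simpa using h0)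
  have B := lb_half V U T hU c hc h0 h1
  have B' := mul_le_mul_of_nonneg_left B hq
  refine le_trans ?_ (mul_le_mul_of_nonneg_left (add_le_add A B') (by norm_num : (0:ℝ) ≤ 2))
  have e : q * ∑ i, c i * ∑ j, ‖(star V * T * U) i j‖ ^ 2 =
      ∑ i, ∑ j, q * c j * ‖(star U * T * V) i j‖ ^ 2 := by
    rw [Finset.sum_comm, Finset.mul_sum]
    refine Finset.sum_congr rfl fun j _ => ?_
    rw [Finset.mul_sum, Finset.mul_sum]
    refine Finset.sum_congr rfl fun i _ => ?_
    have : star V * T * U = star (star U * T * V) := by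
      rw [star_mul, star_mul, star_star, Matrix.star_eq_conjTranspose T, h0.1.eq, mul_assoc]
    rw [this, Matrix.star_apply, norm_star]; ring
  rw [e, Fintype.sum_prod_type]
  simp only [Finset.mul_sum]
  rw [← Finset.sum_add_distrib, Finset.mul_sum]
  refine Finset.sum_le_sum fun i _ => ?_
  rw [← Finset.sum_add_distrib, Finset.mul_sum]
  refine Finset.sum_le_sum fun j _ => ?_
  have hs : (star U * V) i j = (star U * (1 - T) * V) i j + (star U * T * V) i j := by
    rw [← Matrix.add_apply, ← add_mul, ← mul_add, sub_add_cancel, mul_one]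
  rw [hs]
  set x := (star U * (1 - T) * V) i j
  set z := (star U * T * V) i j
  have hn := norm_add_le x z
  have hm : 0 ≤ min (a i) (q * c j) := le_min (ha i) (mul_nonneg hq (hc j))
  have hx := mul_le_mul_of_nonneg_right (min_le_left (a i) (q * c j)) (sq_nonneg ‖x‖)
  have hz := mul_le_mul_of_nonneg_right (min_le_right (a i) (q * c j)) (sq_nonneg ‖z‖)
  have h2 : ‖x + z‖ ^ 2 ≤ 2 * (‖x‖ ^ 2 + ‖z‖ ^ 2) := by
    nlinarith [norm_nonneg (x + z), norm_nonneg x, norm_nonneg z, sq_nonneg (‖x‖ - ‖z‖)]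
  have := mul_le_mul_of_nonneg_left h2 hm
  linarith

lemma lb_tp_mul {d : ℕ} (A B : Matrix (Fin d) (Fin d) ℂ) (n : ℕ) :
    tensorPow (A * B) n = tensorPow A n * tensorPow B n := by
  ext v w
  simp only [tensorPow, Matrix.mul_apply, ← Finset.prod_mul_distrib]
  rw [Finset.prod_univ_sum, Fintype.piFinset_univ]

lemma lb_tp_star {d : ℕ} (A : Matrix (Fin d) (Fin d) ℂ) (n : ℕ) :
    tensorPow (star A) n = star (tensorPow A n) := by
  ext v w
  simp only [tensorPow, Matrix.star_apply, star_prod]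

lemma lb_tp_diag {d : ℕ} (a : Fin d → ℝ) (n : ℕ) :
    tensorPow (Matrix.diagonal (fun i => (a i : ℂ))) n =
      Matrix.diagonal (fun v => ((∏ t, a (v t) : ℝ) : ℂ)) := by
  ext v w
  simp only [tensorPow, Matrix.diagonal_apply]
  by_cases h : v = w
  · subst h; simp
  · rw [if_neg h]
    obtain ⟨t, ht⟩ := Function.ne_iff.1 h
    exact Finset.prod_eq_zero (Finset.mem_univ t) (if_neg ht)

lemma lb_tp_one {d : ℕ} (n : ℕ) : tensorPow (1 : Matrix (Fin d) (Fin d) ℂ) n = 1 := by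
  have := lb_tp_diag (d := d) (fun _ => 1) n
  simpa using this

lemma lb_mpow {d : ℕ} (A : Matrix (Fin d) (Fin d) ℂ) (h : A.IsHermitian) (t : ℝ) :
    mpow A t = (h.eigenvectorUnitary : Matrix (Fin d) (Fin d) ℂ) *
      Matrix.diagonal (fun i => ((h.eigenvalues i ^ t : ℝ) : ℂ)) *
      star (h.eigenvectorUnitary : Matrix (Fin d) (Fin d) ℂ) := by
  unfold mpow; rw [dif_pos h]

lemma lb_mlog {d : ℕ} (A : Matrix (Fin d) (Fin d) ℂ) (h : A.IsHermitian) :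
    mlog A = (h.eigenvectorUnitary : Matrix (Fin d) (Fin d) ℂ) *
      Matrix.diagonal (fun i => ((Real.log (h.eigenvalues i) : ℝ) : ℂ)) *
      star (h.eigenvectorUnitary : Matrix (Fin d) (Fin d) ℂ) := by
  unfold mlog; rw [dif_pos h]

lemma lb_spec {d : ℕ} (A : Matrix (Fin d) (Fin d) ℂ) (h : A.IsHermitian) :
    A = (h.eigenvectorUnitary : Matrix (Fin d) (Fin d) ℂ) *
      Matrix.diagonal (fun i => ((h.eigenvalues i : ℝ) : ℂ)) *
      star (h.eigenvectorUnitary : Matrix (Fin d) (Fin d) ℂ) := by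
  conv_lhs => rw [h.spectral_theorem]
  rw [Unitary.conjStarAlgAut_apply]
  rfl

lemma lb_relent {d : ℕ} (ρ σ : Matrix (Fin d) (Fin d) ℂ) (h : ρ.IsHermitian)
    (g : σ.IsHermitian) :
    qRelEnt ρ σ = ∑ k : Fin d × Fin d,
      ‖(star (h.eigenvectorUnitary : Matrix (Fin d) (Fin d) ℂ) * (g.eigenvectorUnitary : Matrix (Fin d) (Fin d) ℂ))
        k.1 k.2‖ ^ 2 * (h.eigenvalues k.1 *
          (Real.log (h.eigenvalues k.1) - Real.log (g.eigenvalues k.2))) := by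
  have hU : star (h.eigenvectorUnitary : Matrix (Fin d) (Fin d) ℂ) *
    (h.eigenvectorUnitary : Matrix (Fin d) (Fin d) ℂ) = 1 := Unitary.coe_star_mul_self _
  have hV : (g.eigenvectorUnitary : Matrix (Fin d) (Fin d) ℂ) *
    star (g.eigenvectorUnitary : Matrix (Fin d) (Fin d) ℂ) = 1 := Unitary.coe_mul_star_self _
  unfold qRelEnt
  rw [mul_sub, Matrix.trace_sub, Complex.sub_re]
  have e2 : ρ * mlog σ = (h.eigenvectorUnitary : Matrix (Fin d) (Fin d) ℂ) *
      Matrix.diagonal (fun i => ((h.eigenvalues i : ℝ) : ℂ)) *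
      star (h.eigenvectorUnitary : Matrix (Fin d) (Fin d) ℂ) * ((g.eigenvectorUnitary : Matrix (Fin d) (Fin d) ℂ) *
      Matrix.diagonal (fun i => ((Real.log (g.eigenvalues i) : ℝ) : ℂ)) *
      star (g.eigenvectorUnitary : Matrix (Fin d) (Fin d) ℂ)) := by
    rw [← lb_spec ρ h, ← lb_mlog σ g]
  have e1 : ρ * mlog ρ = (h.eigenvectorUnitary : Matrix (Fin d) (Fin d) ℂ) *
      Matrix.diagonal (fun i => ((h.eigenvalues i * Real.log (h.eigenvalues i) : ℝ) : ℂ)) *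
      star (h.eigenvectorUnitary : Matrix (Fin d) (Fin d) ℂ) * ((g.eigenvectorUnitary : Matrix (Fin d) (Fin d) ℂ) *
      Matrix.diagonal (fun _ => ((1 : ℝ) : ℂ)) *
      star (g.eigenvectorUnitary : Matrix (Fin d) (Fin d) ℂ)) := by
    rw [lb_mlog ρ h]
    conv_lhs => arg 1; rw [lb_spec ρ h]
    generalize (h.eigenvectorUnitary : Matrix (Fin d) (Fin d) ℂ) = U at *
    generalize (g.eigenvectorUnitary : Matrix (Fin d) (Fin d) ℂ) = V at *
    have : (Matrix.diagonal (fun _ : Fin d => ((1 : ℝ) : ℂ))) = 1 := by simp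
    rw [this, mul_one, hV, mul_one]
    have e : ∀ D E : Matrix (Fin d) (Fin d) ℂ,
        U * D * star U * (U * E * star U) = U * (D * E) * star U := by
      intro D E
      calc _ = U * D * (star U * U) * E * star U := by simp only [mul_assoc]
        _ = _ := by rw [hU]; simp only [mul_assoc, mul_one]
    rw [e, Matrix.diagonal_mul_diagonal]
    simp
  rw [e1, e2, lb_trace_two, lb_trace_two, ← Finset.sum_sub_distrib]
  refine Finset.sum_congr rfl fun k _ => ?_
  ring


/-- For every `b` with `−D(ρ‖σ) < b < D(σ‖ρ)` and every sequence of tests `{Tₙ}`,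
`−b − Ψ(b) ≤ max{liminf (1/n)·log αₙ[Tₙ], −b + limsup (1/n)·log βₙ[Tₙ]}`,
where `Ψ(b) = max_{s∈ℝ}(b·s − φ(s+1))`. -/
theorem liminf_limsup_bound {d : ℕ} (ρ σ : Matrix (Fin d) (Fin d) ℂ)
    (hρ : ρ.PosDef) (hρ1 : ρ.trace = 1)
    (hσ : σ.PosDef) (hσ1 : σ.trace = 1)
    (Ψ : ℝ → ℝ)
    (hΨ : ∀ b, Ψ b = ⨆ s : ℝ, (b * s - qphi ρ σ (s + 1)))
    (b : ℝ) (hb1 : -(qRelEnt ρ σ) < b) (hb2 : b < qRelEnt σ ρ)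
    (T : (n : ℕ) → Matrix (Fin n → Fin d) (Fin n → Fin d) ℂ)
    (hT : ∀ n, (T n).PosSemidef ∧ (1 - T n).PosSemidef) :
    -b - Ψ b ≤ max
      (liminf (fun n : ℕ =>
        (1 / (n : ℝ)) * Real.log (((tensorPow ρ n * (1 - T n)).trace).re)) atTop)
      (-b + limsup (fun n : ℕ =>
        (1 / (n : ℝ)) * Real.log (((tensorPow σ n * T n).trace).re)) atTop) := by
  set l : Fin d → ℝ := hρ.1.eigenvalues with hl
  set m : Fin d → ℝ := hσ.1.eigenvalues with hm
  set U : Matrix (Fin d) (Fin d) ℂ := (hρ.1.eigenvectorUnitary : Matrix (Fin d) (Fin d) ℂ) with hU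
  set V : Matrix (Fin d) (Fin d) ℂ := (hσ.1.eigenvectorUnitary : Matrix (Fin d) (Fin d) ℂ) with hV
  have hU1 : U * star U = 1 := Unitary.coe_mul_star_self _
  have hV1 : V * star V = 1 := Unitary.coe_mul_star_self _
  have hl0 : ∀ i, 0 < l i := fun i => hρ.eigenvalues_pos i
  have hm0 : ∀ i, 0 < m i := fun i => hσ.eigenvalues_pos i
  have hρs : ρ = U * Matrix.diagonal (fun i => (l i : ℂ)) * star U := lb_spec ρ hρ.1
  have hσs : σ = V * Matrix.diagonal (fun i => (m i : ℂ)) * star V := lb_spec σ hσ.1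
  set o : Fin d × Fin d → ℝ := fun k => ‖(star U * V) k.1 k.2‖ ^ 2 with ho
  have ho0 : ∀ k, 0 ≤ o k := fun k => by positivity
  set Q : ℝ → ℝ := fun s => ∑ k : Fin d × Fin d, o k * (l k.1 ^ (1 - s) * m k.2 ^ s) with hQ
  have hφ : ∀ s, qphi ρ σ s = Real.log (Q s) := by
    intro s
    unfold qphi
    rw [lb_mpow ρ hρ.1, lb_mpow σ hσ.1, lb_trace_two]
  have hD1 : qRelEnt ρ σ = ∑ k : Fin d × Fin d, o k *
      (l k.1 * (Real.log (l k.1) - Real.log (m k.2))) := lb_relent ρ σ hρ.1 hσ.1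
  have hD2 : qRelEnt σ ρ = ∑ k : Fin d × Fin d, o k *
      (m k.2 * (Real.log (m k.2) - Real.log (l k.1))) := by
    rw [lb_relent σ ρ hσ.1 hρ.1]
    refine Fintype.sum_equiv (Equiv.prodComm _ _) _ _ fun k => ?_
    have : star V * U = star (star U * V) := by rw [star_mul, star_star]
    rw [← hU, ← hV, this, Matrix.star_apply, norm_star]
    rfl
  have hone : (Matrix.diagonal (fun _ : Fin d => ((1 : ℝ) : ℂ))) = 1 := by simp
  have hP1 : ∑ k : Fin d × Fin d, o k * l k.1 = 1 := by
    have h := lb_trace_two U V l (fun _ => 1)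
    rw [hone, mul_one, hV1, mul_one, ← hρs, hρ1] at h
    simpa using h.symm
  have hP2 : ∑ k : Fin d × Fin d, o k * m k.2 = 1 := by
    have h := lb_trace_two U V (fun _ => 1) m
    rw [hone, mul_one, hU1, one_mul, ← hσs, hσ1] at h
    simpa using h.symm
  have hQ0 : Q 0 = 1 := by simpa [hQ] using hP1
  have hQ1 : Q 1 = 1 := by simpa [hQ] using hP2
  have hw : ∀ (s : ℝ) (k : Fin d × Fin d), 0 < l k.1 ^ (1 - s) * m k.2 ^ s := fun s k =>
    mul_pos (Real.rpow_pos_of_pos (hl0 _) _) (Real.rpow_pos_of_pos (hm0 _) _)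
  have hQpos : ∀ s, 0 < Q s := by
    intro s
    obtain ⟨k, hk⟩ : ∃ k, o k ≠ 0 := by
      by_contra hcon
      push Not at hcon
      simp [hcon] at hP1
    exact Finset.sum_pos' (fun k _ => mul_nonneg (ho0 k) (hw s k).le)
      ⟨k, Finset.mem_univ _, mul_pos (lt_of_le_of_ne (ho0 k) hk.symm) (hw s k)⟩
  set G : ℝ → ℝ := fun s => ∑ k : Fin d × Fin d, o k * (l k.1 ^ (1 - s) * m k.2 ^ s) *
    (Real.log (m k.2) - Real.log (l k.1) - b) with hG
  have hGc : Continuous G := by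
    refine continuous_finset_sum _ fun k _ => ?_
    refine Continuous.mul (continuous_const.mul (Continuous.mul ?_ ?_)) continuous_const
    · exact continuous_const.rpow (by fun_prop) (fun _ => Or.inl (hl0 _).ne')
    · exact continuous_const.rpow continuous_id (fun _ => Or.inl (hm0 _).ne')
  have hG0 : G 0 < 0 := by
    have : G 0 = -qRelEnt ρ σ - b * ∑ k : Fin d × Fin d, o k * l k.1 := by
      rw [hD1, Finset.mul_sum, ← Finset.sum_neg_distrib, ← Finset.sum_sub_distrib]
      refine Finset.sum_congr rfl fun k _ => ?_
      simp only [sub_zero, Real.rpow_one, Real.rpow_zero]; ring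
    rw [this, hP1]; linarith
  have hG1 : 0 < G 1 := by
    have : G 1 = qRelEnt σ ρ - b * ∑ k : Fin d × Fin d, o k * m k.2 := by
      rw [hD2, Finset.mul_sum, ← Finset.sum_sub_distrib]
      refine Finset.sum_congr rfl fun k _ => ?_
      simp only [sub_self, Real.rpow_one, Real.rpow_zero]; ring
    rw [this, hP2]; linarith
  obtain ⟨s, ⟨hs0, hs1⟩, hGs⟩ : ∃ s ∈ Set.Icc (0:ℝ) 1, G s = 0 :=
    intermediate_value_Icc zero_le_one hGc.continuousOn ⟨hG0.le, hG1.le⟩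
  -- tangent inequality
  have htan : ∀ s', Real.log (Q s) + (s' - s) * b ≤ Real.log (Q s') := by
    intro s'
    have hQs := hQpos s
    have hJ := lb_jensen (fun k : Fin d × Fin d => o k * (l k.1 ^ (1 - s) * m k.2 ^ s) / Q s)
      (fun k => (s' - s) * (Real.log (m k.2) - Real.log (l k.1)))
      (fun k => div_nonneg (mul_nonneg (ho0 k) (hw s k).le) hQs.le)
      (by rw [← Finset.sum_div]; exact div_self hQs.ne')
    have e1 : ∑ k : Fin d × Fin d, o k * (l k.1 ^ (1 - s) * m k.2 ^ s) / Q s *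
        ((s' - s) * (Real.log (m k.2) - Real.log (l k.1))) = (s' - s) * b := by
      have : ∀ k : Fin d × Fin d, o k * (l k.1 ^ (1 - s) * m k.2 ^ s) / Q s *
        ((s' - s) * (Real.log (m k.2) - Real.log (l k.1))) =
        (s' - s) / Q s * (o k * (l k.1 ^ (1 - s) * m k.2 ^ s) *
          (Real.log (m k.2) - Real.log (l k.1) - b)) +
        (s' - s) * b / Q s * (o k * (l k.1 ^ (1 - s) * m k.2 ^ s)) := by intro k; ring
      rw [Finset.sum_congr rfl fun k _ => this k, Finset.sum_add_distrib, ← Finset.mul_sum,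
        ← Finset.mul_sum]
      change (s' - s) / Q s * G s + (s' - s) * b / Q s * Q s = _
      rw [hGs]; field_simp; ring
    have e2 : ∑ k : Fin d × Fin d, o k * (l k.1 ^ (1 - s) * m k.2 ^ s) / Q s *
        Real.exp ((s' - s) * (Real.log (m k.2) - Real.log (l k.1))) = Q s' / Q s := by
      rw [show Q s' = ∑ k : Fin d × Fin d, o k * (l k.1 ^ (1 - s') * m k.2 ^ s') from rfl,
        Finset.sum_div]
      refine Finset.sum_congr rfl fun k _ => ?_
      rw [div_mul_eq_mul_div, mul_assoc]
      congr 2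
      rw [Real.rpow_def_of_pos (hl0 _), Real.rpow_def_of_pos (hm0 _),
        Real.rpow_def_of_pos (hl0 _), Real.rpow_def_of_pos (hm0 _), ← Real.exp_add,
        ← Real.exp_add, ← Real.exp_add]
      congr 1; ring
    rw [e1, e2] at hJ
    have := (Real.le_log_iff_exp_le (div_pos (hQpos s') hQs)).2 hJ
    rw [Real.log_div (hQpos s').ne' hQs.ne'] at this
    linarith
  have hbdd : BddAbove (Set.range fun s : ℝ => b * s - qphi ρ σ (s + 1)) := by
    refine ⟨b * (s - 1) - Real.log (Q s), ?_⟩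
    rintro _ ⟨x, rfl⟩
    have := htan (x + 1)
    simp only [hφ]
    linarith
  have hΨge : ∀ x, b * x - Real.log (Q (x + 1)) ≤ Ψ b := by
    intro x
    rw [hΨ, ← hφ]
    exact le_ciSup hbdd x
  have hΨ0 : 0 ≤ Ψ b := by simpa [hQ1] using hΨge 0
  have hΨ1 : -b ≤ Ψ b := by simpa [hQ0] using hΨge (-1)
  have hΨs : -b - Ψ b ≤ Real.log (Q s) - s * b := by
    have := hΨge (s - 1)
    rw [sub_add_cancel] at this
    linarith
  obtain ⟨W, hW⟩ := lb_classical o (fun k => l k.1) (fun k => m k.2) ho0 (fun k => hl0 _)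
    (fun k => hm0 _) b s (Q s) hs0 hs1 rfl (hQpos s) hGs
  refine lb_final _ _ _ b ((W + 1) / 2) (by linarith) (by linarith) fun n hn => ?_
  have hUn : tensorPow U n * star (tensorPow U n) = 1 := by
    rw [← lb_tp_star, ← lb_tp_mul, hU1, lb_tp_one]
  have hVn : tensorPow V n * star (tensorPow V n) = 1 := by
    rw [← lb_tp_star, ← lb_tp_mul, hV1, lb_tp_one]
  have hρn : tensorPow ρ n = tensorPow U n *
      Matrix.diagonal (fun v => ((∏ t, l (v t) : ℝ) : ℂ)) * star (tensorPow U n) := by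
    rw [hρs, lb_tp_mul, lb_tp_mul, lb_tp_star, lb_tp_diag]
  have hσn : tensorPow σ n = tensorPow V n *
      Matrix.diagonal (fun v => ((∏ t, m (v t) : ℝ) : ℂ)) * star (tensorPow V n) := by
    rw [hσs, lb_tp_mul, lb_tp_mul, lb_tp_star, lb_tp_diag]
  have hTn := lb_test (tensorPow U n) (tensorPow V n) (T n) hUn hVn
    (fun v => ∏ t, l (v t)) (fun v => ∏ t, m (v t))
    (fun v => Finset.prod_nonneg fun t _ => (hl0 _).le)
    (fun v => Finset.prod_nonneg fun t _ => (hm0 _).le) (hT n).1 (hT n).2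
    (Real.exp (-(n * b))) (Real.exp_pos _).le
  rw [← hρn, ← hσn] at hTn
  refine le_trans ?_ hTn
  have hWn := hW n hn
  have hre : ∑ k : Fin n → Fin d × Fin d, min (∏ t, l (k t).1)
      (Real.exp (-(n * b)) * ∏ t, m (k t).2) * ∏ t, o (k t) =
      ∑ k : (Fin n → Fin d) × (Fin n → Fin d), min (∏ t, l (k.1 t))
      (Real.exp (-(n * b)) * ∏ t, m (k.2 t)) *
        ‖(star (tensorPow U n) * tensorPow V n) k.1 k.2‖ ^ 2 := by
    refine Fintype.sum_equiv (Equiv.arrowProdEquivProdArrow _ _ _) _ _ fun k => ?_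
    rw [← lb_tp_star, ← lb_tp_mul]
    simp only [tensorPow, norm_prod, Finset.prod_pow, ho]
    rfl
  rw [← hre]
  refine le_trans ?_ hWn
  rw [mul_div_assoc]
  exact mul_le_mul_of_nonneg_right (Real.exp_le_exp.2
    (mul_le_mul_of_nonneg_left hΨs (by positivity))) (Real.exp_pos _).le
end
end

section
/- Let ρ and σ be faithful density operators on a finite-dimensional complex Hilbert space. Then for every s with 0 ≤ s ≤ 1, Tr[e^{(1−s)·log ρ + s·log σ}] ≤ Tr[ρ^{1−s} σ^{s}], i.e. φ̃(s) ≤ φ(s) where φ̃(s) := log Tr[e^{(1−s)log ρ + s log σ}] and φ(s) := log Tr[ρ^{1−s}σ^{s}]. -/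
open scoped Matrix ComplexOrder
open Filter

noncomputable section

theorem gt_pow_sub {R : Type*} [NormedRing R] [NormOneClass R] (x y : R) (c : ℝ) (hc : 1 ≤ c)
    (hx : ‖x‖ ≤ c) (hy : ‖y‖ ≤ c) (n : ℕ) : ‖x ^ n - y ^ n‖ ≤ n * c ^ n * ‖x - y‖ := by
  induction n with
  | zero => simp
  | succ n ih =>
    have h1 : x ^ (n+1) - y ^ (n+1) = x ^ n * (x - y) + (x ^ n - y ^ n) * y := by
      rw [pow_succ, pow_succ]; noncomm_ring
    have h2 : ‖x ^ n‖ ≤ c ^ n := (norm_pow_le x n).trans (by gcongr)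
    have h3 : c ^ n ≤ c ^ (n+1) := pow_le_pow_right₀ hc (by omega)
    calc ‖x ^ (n+1) - y ^ (n+1)‖ ≤ ‖x ^ n‖ * ‖x - y‖ + ‖x ^ n - y ^ n‖ * ‖y‖ := by
          rw [h1]; exact (norm_add_le _ _).trans (add_le_add (norm_mul_le _ _) (norm_mul_le _ _))
      _ ≤ c ^ (n+1) * ‖x - y‖ + (n * c ^ n * ‖x - y‖) * c := by
          gcongr
          exact h2.trans h3
      _ = _ := by push_cast; ring

theorem gt_trotter {R : Type*} [NormedRing R] [NormOneClass R] [NormedAlgebra ℝ R] [CompleteSpace R]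
    (A B : R) :
    Tendsto (fun m : ℕ => (NormedSpace.exp ((1 / (m:ℝ)) • A) * NormedSpace.exp ((1 / (m:ℝ)) • B)) ^ m)
      atTop (nhds (NormedSpace.exp (A + B))) := by
  have hA := hasDerivAt_exp_smul_const (𝕂 := ℝ) A (0:ℝ)
  have hB := hasDerivAt_exp_smul_const (𝕂 := ℝ) B (0:ℝ)
  have hC := hasDerivAt_exp_smul_const (𝕂 := ℝ) (A + B) (0:ℝ)
  have hAB := hA.mul hB
  have hf := (hAB.sub hC).isLittleO
  have hg := hAB.differentiableAt.isBigO_sub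
  have hc := hC.differentiableAt.isBigO_sub
  have ht : Tendsto (fun m : ℕ => (1 / (m:ℝ))) atTop (nhds 0) := tendsto_one_div_atTop_nhds_zero_nat
  simp at hf hg hc
  obtain ⟨K, hK0, hK⟩ := (hg.comp_tendsto ht).exists_pos
  obtain ⟨L, hL0, hL⟩ := (hc.comp_tendsto ht).exists_pos
  have hf' := hf.comp_tendsto ht
  have hf2 := (hf'.norm_left.norm_right).tendsto_div_nhds_zero
  rw [tendsto_iff_norm_sub_tendsto_zero]
  have hlim := hf2.const_mul (Real.exp (K + L))
  rw [mul_zero] at hlim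
  refine squeeze_zero' (Eventually.of_forall fun _ => norm_nonneg _) ?_ hlim
  filter_upwards [hK.bound, hL.bound, eventually_gt_atTop 0] with m h1 h2 hm
  have hm' : (0:ℝ) < m := by exact_mod_cast hm
  simp only [← smul_add, Function.comp, norm_div, norm_one, Real.norm_natCast] at h1 h2 ⊢
  set X := NormedSpace.exp ((1 / (m:ℝ)) • A) * NormedSpace.exp ((1 / (m:ℝ)) • B)
  have hY : NormedSpace.exp (A + B) = NormedSpace.exp ((1 / (m:ℝ)) • (A + B)) ^ m := by
    let _ : NormedAlgebra ℚ R := NormedAlgebra.restrictScalars ℚ ℝ R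
    rw [← NormedSpace.exp_nsmul, ← Nat.cast_smul_eq_nsmul ℝ, smul_smul]
    field_simp; simp
  rw [hY]
  set Y := NormedSpace.exp ((1 / (m:ℝ)) • (A + B))
  have hc1 : 1 ≤ 1 + (K + L) / m := by
    have : 0 ≤ (K + L) / m := by positivity
    linarith
  have hX1 : ‖X‖ ≤ 1 + (K + L) / m := by
    have := norm_le_norm_add_norm_sub' X 1
    rw [norm_one] at this
    refine this.trans ?_
    have : K * (1 / m) ≤ (K + L)/m := by rw [mul_one_div]; gcongr; linarith
    linarith
  have hY1 : ‖Y‖ ≤ 1 + (K + L) / m := by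
    have := norm_le_norm_add_norm_sub' Y 1
    rw [norm_one] at this
    refine this.trans ?_
    have : L * (1 / m) ≤ (K + L)/m := by rw [mul_one_div]; gcongr; linarith
    linarith
  have h5 := gt_pow_sub X Y _ hc1 hX1 hY1 m
  refine h5.trans ?_
  have h6 : (1 + (K + L) / m) ^ m ≤ Real.exp (K + L) := by
    calc (1 + (K + L) / m) ^ m ≤ (Real.exp ((K + L) / m)) ^ m := by
          gcongr; rw [add_comm]; exact Real.add_one_le_exp _
      _ = _ := by rw [← Real.exp_nat_mul]; field_simp
  calc m * (1 + (K + L) / m) ^ m * ‖X - Y‖ ≤ m * Real.exp (K + L) * ‖X - Y‖ := by gcongr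
    _ = _ := by field_simp
open Matrix in
theorem gt_peierls {d : ℕ} (A : Matrix (Fin d) (Fin d) ℂ) (hA : A.PosSemidef) (m : ℕ) :
    ∑ i, (A i i).re ^ m ≤ ((A ^ m).trace).re := by
  have h := hA.1
  set U : Matrix (Fin d) (Fin d) ℂ := (h.eigenvectorUnitary : Matrix (Fin d) (Fin d) ℂ) with hU
  have hU1 : star U * U = 1 := by simp [hU]
  have hU2 : U * star U = 1 := by simp [hU]
  have hsp : A = U * diagonal (fun i => (h.eigenvalues i : ℂ)) * star U := by
    have := h.spectral_theorem
    rw [Unitary.conjStarAlgAut_apply] at this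
    exact this
  have hpow : A ^ m = U * diagonal (fun i => ((h.eigenvalues i ^ m : ℝ) : ℂ)) * star U := by
    clear_value U
    generalize h.eigenvalues = e at *
    subst hsp
    induction m with
    | zero => simp [hU2]
    | succ m ih =>
      rw [pow_succ, ih]
      calc _ = U * diagonal _ * (star U * U) * diagonal _ * star U := by noncomm_ring
        _ = _ := by rw [hU1, mul_one, mul_assoc U, diagonal_mul_diagonal]; simp [pow_succ]
  have hent : ∀ (f : Fin d → ℝ) (i), ((U * diagonal (fun i => (f i : ℂ)) * star U) i i).re
      = ∑ j, Complex.normSq (U i j) * f j := by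
    intro f i
    rw [mul_apply]
    simp only [mul_diagonal, star_apply, Complex.re_sum]
    refine Finset.sum_congr rfl fun j _ => ?_
    simp [Complex.normSq_apply]; ring
  have hrow : ∀ i, ∑ j, Complex.normSq (U i j) = 1 := by
    intro i
    have := hent (fun _ => 1) i
    simp [hU2] at this
    exact this.symm
  have hcol : ∀ j, ∑ i, Complex.normSq (U i j) = 1 := by
    intro j
    have := congrArg (fun M => (M j j).re) hU1
    simp [mul_apply] at this
    rw [← this]
    refine Finset.sum_congr rfl fun i _ => ?_
    simp [Complex.normSq_apply]
  calc ∑ i, (A i i).re ^ m = ∑ i, (∑ j, Complex.normSq (U i j) * h.eigenvalues j) ^ m := by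
        refine Finset.sum_congr rfl fun i _ => ?_
        rw [← hent, ← hsp]
    _ ≤ ∑ i, ∑ j, Complex.normSq (U i j) * h.eigenvalues j ^ m := by
        refine Finset.sum_le_sum fun i _ => ?_
        exact Real.pow_arith_mean_le_arith_mean_pow _ _ _ (fun j _ => Complex.normSq_nonneg _)
          (hrow i) (fun j _ => hA.eigenvalues_nonneg j) m
    _ = ((A ^ m).trace).re := by
        rw [hpow, trace, Complex.re_sum]
        refine Finset.sum_congr rfl fun i _ => ?_
        rw [diag_apply, hent]

open Matrix in
theorem gt_qr {d : ℕ} (V : Matrix (Fin d) (Fin d) ℂ) :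
    ∃ Q R : Matrix (Fin d) (Fin d) ℂ, star Q * Q = 1 ∧ Q * star Q = 1 ∧ V = Q * R ∧
      R.BlockTriangular id := by
  let f : Fin d → EuclideanSpace ℂ (Fin d) := fun j => WithLp.toLp 2 (fun i => V i j)
  have hd : Module.finrank ℂ (EuclideanSpace ℂ (Fin d)) = Fintype.card (Fin d) := by simp
  let b := InnerProductSpace.gramSchmidtOrthonormalBasis hd f
  let e := EuclideanSpace.basisFun (Fin d) ℂ
  have hQ := e.toMatrix_orthonormalBasis_mem_unitary b
  refine ⟨e.toBasis.toMatrix b, b.toBasis.toMatrix f, ?_, ?_, ?_,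
    InnerProductSpace.gramSchmidtOrthonormalBasis_inv_isUpperTriangular hd f⟩
  · exact mem_unitaryGroup_iff'.1 hQ
  · exact mem_unitaryGroup_iff.1 hQ
  · have : e.toBasis.toMatrix b.toBasis * b.toBasis.toMatrix f = e.toBasis.toMatrix f :=
      Module.Basis.toMatrix_mul_toMatrix _ _ _
    rw [OrthonormalBasis.coe_toBasis] at this
    rw [this]
    ext i j
    simp [Module.Basis.toMatrix_apply, e, f]

open Matrix in
theorem gt_weyl {d : ℕ} (N V W : Matrix (Fin d) (Fin d) ℂ) (D : Fin d → ℝ)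
    (hVW : V * W = 1) (hN : N = V * diagonal (fun i => (D i : ℂ)) * W) (m : ℕ) :
    ((N ^ (2 * m)).trace).re ≤ (((star N * N) ^ m).trace).re := by
  have hWV : W * V = 1 := mul_eq_one_comm.1 hVW
  obtain ⟨Q, R, hQ1, hQ2, hV, hR⟩ := gt_qr V
  have hRinv : R * (W * Q) = 1 := by
    have : star Q * (V * W) * Q = 1 := by rw [hVW, mul_one, hQ1]
    rw [← this, hV]
    calc R * (W * Q) = 1 * (R * (W * Q)) := by rw [one_mul]
      _ = _ := by rw [← hQ1]; noncomm_ring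
  have hRi : (W * Q).BlockTriangular id := by
    rw [← inv_eq_right_inv hRinv]
    let _ := invertibleOfRightInverse R _ hRinv
    exact blockTriangular_inv_of_blockTriangular hR
  have hpow : ∀ k, N ^ k = V * diagonal (fun i => ((D i ^ k : ℝ) : ℂ)) * W := by
    intro k
    induction k with
    | zero => simp [hVW]
    | succ k ih =>
      rw [pow_succ, ih, hN]
      calc _ = V * diagonal _ * (W * V) * diagonal _ * W := by noncomm_ring
        _ = _ := by rw [hWV, mul_one, mul_assoc V, diagonal_mul_diagonal]; simp [pow_succ]
  have htr : ((N ^ (2 * m)).trace).re = ∑ i, (D i ^ 2) ^ m := by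
    rw [hpow, trace_mul_comm, ← mul_assoc, hWV, one_mul, trace_diagonal, Complex.re_sum]
    simp only [Complex.ofReal_re, pow_mul]
  set S := W * Q with hS
  set E := R * diagonal (fun i => (D i : ℂ)) * S with hE
  have hEN : E = star Q * N * Q := by
    rw [hN, hV, hE, hS]
    calc _ = 1 * (R * diagonal (fun i => (D i : ℂ)) * (W * Q)) := by rw [one_mul]
      _ = _ := by rw [← hQ1]; noncomm_ring
  have hdiag : ∀ (M : Matrix (Fin d) (Fin d) ℂ) i, M.BlockTriangular id → (M * S) i i = M i i * S i i := by
    intro M i hM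
    rw [mul_apply]
    refine Finset.sum_eq_single i (fun j _ hj => ?_) (by simp)
    rcases lt_or_gt_of_ne hj with h | h
    · rw [hM h, zero_mul]
    · rw [hRi h, mul_zero]
  have hEd : ∀ i, E i i = D i := by
    intro i
    rw [hE, hdiag _ i (hR.mul (blockTriangular_diagonal _)), mul_diagonal]
    have := hdiag R i hR
    rw [hRinv, one_apply_eq] at this
    linear_combination (- (D i : ℂ)) * this
  have hEE : star E * E = star Q * (star N * N) * Q := by
    rw [hEN]
    simp only [star_mul, star_star]
    calc _ = star Q * star N * (Q * star Q) * N * Q := by noncomm_ring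
      _ = _ := by rw [hQ2]; noncomm_ring
  have hEEp : ((star E * E) ^ m).trace = ((star N * N) ^ m).trace := by
    have : (star E * E) ^ m = star Q * (star N * N) ^ m * Q := by
      rw [hEE]
      clear * - hQ1 hQ2
      induction m with
      | zero => simp [hQ1]
      | succ k ih =>
        rw [pow_succ, ih, pow_succ]
        calc _ = star Q * (star N * N) ^ k * (Q * star Q) * (star N * N) * Q := by noncomm_ring
          _ = _ := by rw [hQ2]; noncomm_ring
    rw [this, trace_mul_comm, ← mul_assoc, hQ2, one_mul]
  rw [htr, ← hEEp]
  refine le_trans (Finset.sum_le_sum fun i _ => ?_) (gt_peierls _ (posSemidef_conjTranspose_mul_self E) m)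
  refine pow_le_pow_left₀ (sq_nonneg _) ?_ m
  have : ((Eᴴ * E) i i).re = ∑ j, Complex.normSq (E j i) := by
    rw [mul_apply, Complex.re_sum]
    refine Finset.sum_congr rfl fun j _ => ?_
    simp [Complex.normSq_apply]
  refine le_trans ?_ this.ge
  refine le_trans ?_ (Finset.single_le_sum (fun j _ => Complex.normSq_nonneg (E j i)) (Finset.mem_univ i))
  simp [hEd, sq]

theorem gt_trace_mul_pow {d : ℕ} (A B : Matrix (Fin d) (Fin d) ℂ) (m : ℕ) :
    ((A * B) ^ m).trace = ((B * A) ^ m).trace := by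
  cases m with
  | zero => simp
  | succ m =>
    have : ∀ k, (A * B) ^ (k+1) = A * (B * A) ^ k * B := by
      intro k
      induction k with
      | zero => simp
      | succ k ih => rw [pow_succ, ih, pow_succ]; noncomm_ring
    rw [this, Matrix.trace_mul_comm, ← mul_assoc, ← pow_succ']

open Matrix in
theorem gt_dyadic {d : ℕ} (k : ℕ) : ∀ (X Z : Matrix (Fin d) (Fin d) ℂ), star X = X → star Z = Z →
    IsUnit Z → (((X * (Z * Z)) ^ (2 ^ k)).trace).re ≤ ((X ^ (2 ^ k) * (Z * Z) ^ (2 ^ k)).trace).re := by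
  induction k with
  | zero => intro X Z _ _ _; simp
  | succ k ih =>
    intro X Z hX hZ hu
    have hP : (Z * X * Z).IsHermitian := by
      change star _ = _
      simp only [star_mul, hX, hZ, mul_assoc]
    obtain ⟨Y, hYZ, hZY⟩ : ∃ Y, Y * Z = 1 ∧ Z * Y = 1 := by
      obtain ⟨u, rfl⟩ := hu
      exact ⟨(↑u⁻¹ : Matrix (Fin d) (Fin d) ℂ), by simp, by simp⟩
    obtain ⟨U, hU, D, hsp⟩ : ∃ U : Matrix (Fin d) (Fin d) ℂ, U * star U = 1 ∧
        ∃ D : Fin d → ℝ, Z * X * Z = U * diagonal (fun i => (D i : ℂ)) * star U := by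
      refine ⟨hP.eigenvectorUnitary, by simp, hP.eigenvalues, ?_⟩
      have hsp := hP.spectral_theorem
      rw [Unitary.conjStarAlgAut_apply] at hsp
      exact hsp
    have h1 := gt_weyl (X * (Z * Z)) (Y * U) (star U * Z) D
      (by
        calc _ = Y * (U * star U) * Z := by noncomm_ring
          _ = 1 := by rw [hU, mul_one, hYZ])
      (by
        calc X * (Z * Z) = (Y * Z) * X * (Z * Z) := by rw [hYZ, one_mul]
          _ = Y * (Z * X * Z) * Z := by noncomm_ring
          _ = _ := by rw [hsp]; noncomm_ring) (2 ^ k)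
    rw [pow_succ']
    refine h1.trans ?_
    have h2 : star (X * (Z * Z)) * (X * (Z * Z)) = (Z * Z) * ((X * X) * (Z * Z)) := by
      simp only [star_mul, hX, hZ, mul_assoc]
    rw [h2, gt_trace_mul_pow, mul_assoc]
    refine (ih (X * X) (Z * Z) (by simp [hX]) (by simp [hZ]) (hu.mul hu)).trans (le_of_eq ?_)
    rw [pow_mul, pow_mul, sq, sq]

open Matrix in
theorem gt_matrix_trotter {d : ℕ} (A B : Matrix (Fin d) (Fin d) ℂ) :
    Tendsto (fun m : ℕ => (NormedSpace.exp ((1 / (m:ℝ)) • A) * NormedSpace.exp ((1 / (m:ℝ)) • B)) ^ m)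
      atTop (nhds (NormedSpace.exp (A + B))) := by
  cases d with
  | zero => exact tendsto_const_nhds.congr (fun m => Subsingleton.elim _ _)
  | succ d =>
    let _ : NormedRing (Matrix (Fin (d+1)) (Fin (d+1)) ℂ) := Matrix.linftyOpNormedRing
    let _ : NormedAlgebra ℝ (Matrix (Fin (d+1)) (Fin (d+1)) ℂ) := Matrix.linftyOpNormedAlgebra
    have _ : NormOneClass (Matrix (Fin (d+1)) (Fin (d+1)) ℂ) := Matrix.linfty_opNormOneClass
    exact gt_trotter A B

open Matrix in
theorem golden_thompson {d : ℕ} (A B : Matrix (Fin d) (Fin d) ℂ) (hA : A.IsHermitian)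
    (hB : B.IsHermitian) :
    ((NormedSpace.exp (A + B)).trace).re ≤ ((NormedSpace.exp A * NormedSpace.exp B).trace).re := by
  have h1 := (gt_matrix_trotter A B).comp (tendsto_pow_atTop_atTop_of_one_lt (one_lt_two : 1 < 2))
  have hcont : Continuous (fun M : Matrix (Fin d) (Fin d) ℂ => (M.trace).re) :=
    Complex.continuous_re.comp continuous_id.matrix_trace
  have h2 := (hcont.tendsto _).comp h1
  refine le_of_tendsto h2 (Eventually.of_forall fun k => ?_)
  simp only [Function.comp]
  set m : ℕ := 2 ^ k with hm
  have hm0 : (m : ℝ) ≠ 0 := by simp [hm]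
  have hherm : ∀ (c : ℝ) (M : Matrix (Fin d) (Fin d) ℂ), M.IsHermitian →
      star (NormedSpace.exp (c • M)) = NormedSpace.exp (c • M) := by
    intro c M hM
    have : (c • M).IsHermitian := by
      rw [IsHermitian, conjTranspose_smul, hM.eq]; simp
    exact this.exp
  have hpow : ∀ M : Matrix (Fin d) (Fin d) ℂ, NormedSpace.exp ((1 / (m:ℝ)) • M) ^ m = NormedSpace.exp M := by
    intro M
    rw [← Matrix.exp_nsmul, ← Nat.cast_smul_eq_nsmul ℝ, smul_smul, mul_one_div_cancel hm0, one_smul]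
  have hZ : NormedSpace.exp ((1 / (2 * m:ℝ)) • B) * NormedSpace.exp ((1 / (2 * m:ℝ)) • B)
      = NormedSpace.exp ((1 / (m:ℝ)) • B) := by
    rw [← Matrix.exp_add_of_commute _ _ (Commute.refl _), ← add_smul]
    congr 2
    field_simp
    norm_num
  have h3 := gt_dyadic k (NormedSpace.exp ((1 / (m:ℝ)) • A)) (NormedSpace.exp ((1 / (2 * m:ℝ)) • B))
    (hherm _ _ hA) (hherm _ _ hB) (Matrix.isUnit_exp _)
  rw [hZ, ← hm, hpow, hpow] at h3
  exact h3

open Matrix in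
theorem gt_exp_diag {d : ℕ} (U : Matrix (Fin d) (Fin d) ℂ) (hU : U * star U = 1) (f : Fin d → ℝ) :
    NormedSpace.exp (U * diagonal (fun i => (f i : ℂ)) * star U)
      = U * diagonal (fun i => ((Real.exp (f i) : ℝ) : ℂ)) * star U := by
  have hi : U⁻¹ = star U := inv_eq_right_inv hU
  have hu : IsUnit U := IsUnit.of_mul_eq_one _ hU
  rw [← hi, Matrix.exp_conj _ _ hu, Matrix.exp_diagonal]
  congr 3
  ext i
  rw [Pi.coe_exp, ← Complex.exp_eq_exp_ℂ, Complex.ofReal_exp]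

open Matrix in
theorem gt_mexp {d : ℕ} (A : Matrix (Fin d) (Fin d) ℂ) (h : A.IsHermitian) :
    mexp A = NormedSpace.exp A := by
  rw [mexp, dif_pos h, ← gt_exp_diag _ (by simp)]
  have := h.spectral_theorem
  rw [Unitary.conjStarAlgAut_apply] at this
  exact congrArg _ this.symm

open Matrix in
theorem gt_mlog_herm {d : ℕ} (A : Matrix (Fin d) (Fin d) ℂ) (h : A.IsHermitian) (t : ℝ) :
    (t • mlog A).IsHermitian := by
  have : (mlog A).IsHermitian := by
    rw [mlog, dif_pos h]
    refine isHermitian_mul_mul_conjTranspose _ ?_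
    rw [IsHermitian, diagonal_conjTranspose]
    congr 1
    ext i
    simp
  rw [IsHermitian, conjTranspose_smul, this.eq]; simp

open Matrix in
theorem gt_mpow {d : ℕ} (A : Matrix (Fin d) (Fin d) ℂ) (h : A.PosDef) (t : ℝ) :
    mpow A t = NormedSpace.exp (t • mlog A) := by
  rw [mpow, dif_pos h.1, mlog, dif_pos h.1, ← smul_mul_assoc, ← mul_smul_comm, ← diagonal_smul]
  have : (t • fun i => ((Real.log (h.1.eigenvalues i) : ℝ) : ℂ))
      = fun i => ((t * Real.log (h.1.eigenvalues i) : ℝ) : ℂ) := by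
    ext i; simp
  rw [this, gt_exp_diag _ (by simp)]
  congr 3
  ext i
  rw [Real.rpow_def_of_pos (h.eigenvalues_pos i), mul_comm]

/-- Golden–Thompson consequence: for faithful density operators `ρ, σ` and `0 ≤ s ≤ 1`,
`Tr[e^{(1−s)·log ρ + s·log σ}] ≤ Tr[ρ^{1−s} σ^{s}]`, i.e. `φ̃(s) ≤ φ(s)`. -/
theorem phiTilde_le_phi {d : ℕ} (ρ σ : Matrix (Fin d) (Fin d) ℂ)
    (hρ : ρ.PosDef) (hρ1 : ρ.trace = 1)
    (hσ : σ.PosDef) (hσ1 : σ.trace = 1)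
    (s : ℝ) (hs0 : 0 ≤ s) (hs1 : s ≤ 1) :
    ((mexp ((1 - s) • mlog ρ + s • mlog σ)).trace).re
      ≤ (((mpow ρ (1 - s)) * (mpow σ s)).trace).re := by
  rw [gt_mexp _ ((gt_mlog_herm ρ hρ.1 _).add (gt_mlog_herm σ hσ.1 _)), gt_mpow ρ hρ, gt_mpow σ hσ]
  exact golden_thompson _ _ (gt_mlog_herm ρ hρ.1 _) (gt_mlog_herm σ hσ.1 _)
end
end

section
/- Monotonicity of the quantum Rényi-type trace functional under quantum channels: let ρ and σ be density operators on a finite-dimensional complex Hilbert space and let 𝓔 be a quantum channel (a trace-preserving completely positive linear map) into operators on a finite-dimensional complex Hilbert space. Then for every s with 0 ≤ s ≤ 1, Tr[ρ^{1−s} σ^{s}] ≤ Tr[𝓔(ρ)^{1−s} 𝓔(σ)^{s}]. -/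
open scoped Matrix ComplexOrder
open Filter

noncomputable section

namespace RenyiAux

open Matrix MeasureTheory

variable {n : Type*} [Fintype n] [DecidableEq n]

lemma master (W V X : Matrix n n ℂ) (a b : n → ℝ) :
    ((W * diagonal (fun i => (a i : ℂ)) * Wᴴ * X * (V * diagonal (fun i => (b i : ℂ)) * Vᴴ)
      * Xᴴ).trace).re = ∑ j, ∑ i, a j * b i * Complex.normSq ((Wᴴ * X * V) j i) := by
  have h1 : (W * diagonal (fun i => (a i : ℂ)) * Wᴴ * X * (V * diagonal (fun i => (b i : ℂ)) * Vᴴ)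
      * Xᴴ).trace = (diagonal (fun i => (a i : ℂ)) * ((Wᴴ * X * V) * diagonal (fun i => (b i : ℂ))
        * (Wᴴ * X * V)ᴴ)).trace := by
    simp only [conjTranspose_mul, conjTranspose_conjTranspose, Matrix.mul_assoc]
    rw [Matrix.trace_mul_comm]
    simp only [Matrix.mul_assoc]
  rw [h1]
  generalize Wᴴ * X * V = M
  simp only [Matrix.trace, diag_apply, diagonal_mul, Complex.re_sum]
  refine Finset.sum_congr rfl fun j _ => ?_
  rw [Matrix.mul_apply, Complex.re_ofReal_mul, Complex.re_sum, Finset.mul_sum]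
  refine Finset.sum_congr rfl fun i _ => ?_
  rw [mul_diagonal, conjTranspose_apply, Complex.normSq_apply]
  simp
  ring

/-- The variational functional. -/
def Q (ρ σ : Matrix n n ℂ) (t : ℝ) (X : Matrix n n ℂ) : ℝ :=
  ((σ * (X * Xᴴ)).trace).re + t * ((ρ * ((1 - X)ᴴ * (1 - X))).trace).re

lemma Q_eq (W V X : Matrix n n ℂ) (hW : W * Wᴴ = 1) (hV : V * Vᴴ = 1) (p q : n → ℝ) (t : ℝ) :
    Q (V * diagonal (fun i => (p i : ℂ)) * Vᴴ) (W * diagonal (fun i => (q i : ℂ)) * Wᴴ) t X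
      = ∑ j, ∑ i, (q j * Complex.normSq ((Wᴴ * X * V) j i)
        + t * p i * Complex.normSq ((Wᴴ * V) j i - (Wᴴ * X * V) j i)) := by
  have h1 := master W V X q (fun _ => 1)
  have h2 := master W V (1 - X) (fun _ => 1) p
  have hone : diagonal (fun _ : n => ((1 : ℝ) : ℂ)) = 1 := by
    simp
  rw [hone, Matrix.mul_one, hV, Matrix.mul_one] at h1
  rw [hone, Matrix.mul_one, hW, Matrix.one_mul, Matrix.mul_assoc, Matrix.trace_mul_comm,
    Matrix.mul_assoc] at h2
  unfold Q
  rw [← Matrix.mul_assoc _ X Xᴴ, h1, h2, Finset.mul_sum, ← Finset.sum_add_distrib]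
  refine Finset.sum_congr rfl fun j _ => ?_
  rw [Finset.mul_sum, ← Finset.sum_add_distrib]
  refine Finset.sum_congr rfl fun i _ => ?_
  rw [Matrix.mul_sub, Matrix.sub_mul, Matrix.mul_one, Matrix.sub_apply]
  ring

lemma scalar_le (p q t : ℝ) (hp : 0 ≤ p) (hq : 0 ≤ q) (ht : 0 < t) (u x : ℂ) :
    t * p * q / (t * p + q) * Complex.normSq u
      ≤ q * Complex.normSq x + t * p * Complex.normSq (u - x) := by
  have hn : ∀ z, 0 ≤ Complex.normSq z := Complex.normSq_nonneg
  have htp : 0 ≤ t * p := by positivity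
  rcases (add_nonneg htp hq).eq_or_lt with h | h
  · rw [← h]; simp; have := hn x; have := hn (u - x); positivity
  · rw [div_mul_eq_mul_div, div_le_iff₀ h]
    simp only [Complex.normSq_apply, Complex.sub_re, Complex.sub_im]
    generalize t * p = a at *
    nlinarith [sq_nonneg ((a + q) * x.re - a * u.re), sq_nonneg ((a + q) * x.im - a * u.im)]

lemma scalar_eq (p q t : ℝ) (hp : 0 ≤ p) (hq : 0 ≤ q) (ht : 0 < t) (u : ℂ) :
    t * p * q / (t * p + q) * Complex.normSq u
      = q * Complex.normSq (((t * p / (t * p + q) : ℝ) : ℂ) * u)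
        + t * p * Complex.normSq (u - ((t * p / (t * p + q) : ℝ) : ℂ) * u) := by
  have htp : 0 ≤ t * p := by positivity
  rcases (add_nonneg htp hq).eq_or_lt with h | h
  · have h1 : t * p = 0 := by linarith
    have h2 : q = 0 := by linarith
    simp [h1, h2]
  · have : u - ((t * p / (t * p + q) : ℝ) : ℂ) * u = ((q / (t * p + q) : ℝ) : ℂ) * u := by
      have e : (q / (t * p + q) : ℝ) = 1 - t * p / (t * p + q) := by field_simp; ring
      rw [e]; push_cast; ring
    rw [this, Complex.normSq_mul, Complex.normSq_mul, Complex.normSq_ofReal,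
      Complex.normSq_ofReal]
    generalize t * p = a at *
    field_simp

/-- Value of the variational problem. -/
def F (W V : Matrix n n ℂ) (p q : n → ℝ) (t : ℝ) : ℝ :=
  ∑ j, ∑ i, t * p i * q j / (t * p i + q j) * Complex.normSq ((Wᴴ * V) j i)

lemma F_le (W V X : Matrix n n ℂ) (hW : W * Wᴴ = 1) (hV : V * Vᴴ = 1) (p q : n → ℝ)
    (hp : ∀ i, 0 ≤ p i) (hq : ∀ i, 0 ≤ q i) (t : ℝ) (ht : 0 < t) :
    F W V p q t ≤
    Q (V * diagonal (fun i => (p i : ℂ)) * Vᴴ) (W * diagonal (fun i => (q i : ℂ)) * Wᴴ) t X := by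
  rw [Q_eq W V X hW hV]
  exact Finset.sum_le_sum fun j _ => Finset.sum_le_sum fun i _ =>
    scalar_le _ _ _ (hp i) (hq j) ht _ _

lemma F_eq (W V : Matrix n n ℂ) (hW : W * Wᴴ = 1) (hV : V * Vᴴ = 1) (p q : n → ℝ)
    (hp : ∀ i, 0 ≤ p i) (hq : ∀ i, 0 ≤ q i) (t : ℝ) (ht : 0 < t) :
    ∃ X, F W V p q t =
    Q (V * diagonal (fun i => (p i : ℂ)) * Vᴴ) (W * diagonal (fun i => (q i : ℂ)) * Wᴴ) t X := by
  let M : Matrix n n ℂ := fun j i => ((t * p i / (t * p i + q j) : ℝ) : ℂ) * (Wᴴ * V) j i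
  have hW' : Wᴴ * W = 1 := mul_eq_one_comm.mp hW
  have hV' : Vᴴ * V = 1 := mul_eq_one_comm.mp hV
  refine ⟨W * M * Vᴴ, ?_⟩
  have hM : Wᴴ * (W * M * Vᴴ) * V = M := by
    rw [← Matrix.mul_assoc, ← Matrix.mul_assoc, hW', Matrix.one_mul, Matrix.mul_assoc, hV',
      Matrix.mul_one]
  rw [Q_eq W V _ hW hV, hM]
  exact Finset.sum_congr rfl fun j _ => Finset.sum_congr rfl fun i _ =>
    scalar_eq _ _ _ (hp i) (hq j) ht _

section channel
variable {d d' m : ℕ} (A : Fin m → Matrix (Fin d') (Fin d) ℂ)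

/-- The dual (Heisenberg picture) map. -/
def Phi (X : Matrix (Fin d') (Fin d') ℂ) : Matrix (Fin d) (Fin d) ℂ := ∑ k, (A k)ᴴ * X * A k

lemma Phi_conj (X : Matrix (Fin d') (Fin d') ℂ) : (Phi A X)ᴴ = Phi A Xᴴ := by
  simp [Phi, conjTranspose_sum, Matrix.mul_assoc]

lemma schwarz (hTP : ∑ k, (A k)ᴴ * A k = 1) (X : Matrix (Fin d') (Fin d') ℂ) :
    Phi A (X * Xᴴ) - Phi A X * (Phi A X)ᴴ
      = ∑ k, (Xᴴ * A k - A k * (Phi A X)ᴴ)ᴴ * (Xᴴ * A k - A k * (Phi A X)ᴴ) := by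
  have h : ∀ k, (Xᴴ * A k - A k * (Phi A X)ᴴ)ᴴ * (Xᴴ * A k - A k * (Phi A X)ᴴ)
      = (A k)ᴴ * (X * Xᴴ) * A k - ((A k)ᴴ * X * A k) * (Phi A X)ᴴ
        - Phi A X * ((A k)ᴴ * Xᴴ * A k) + Phi A X * ((A k)ᴴ * A k) * (Phi A X)ᴴ := by
    intro k
    simp only [conjTranspose_sub, conjTranspose_mul, conjTranspose_conjTranspose,
      Matrix.sub_mul, Matrix.mul_sub, Matrix.mul_assoc]
    abel
  simp only [h, Finset.sum_add_distrib, Finset.sum_sub_distrib]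
  rw [← Finset.sum_mul, ← Finset.mul_sum, ← Finset.sum_mul, ← Finset.mul_sum, hTP, Matrix.mul_one]
  have e1 : ∑ k, (A k)ᴴ * X * A k = Phi A X := rfl
  have e2 : ∑ k, (A k)ᴴ * Xᴴ * A k = (Phi A X)ᴴ := (Phi_conj A X).symm
  have e3 : ∑ k, (A k)ᴴ * (X * Xᴴ) * A k = Phi A (X * Xᴴ) := rfl
  rw [e1, e2, e3]
  abel

lemma trace_Phi (ρ : Matrix (Fin d) (Fin d) ℂ) (X : Matrix (Fin d') (Fin d') ℂ) :
    (ρ * Phi A X).trace = ((∑ k, A k * ρ * (A k)ᴴ) * X).trace := by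
  rw [Phi, Finset.mul_sum, Finset.sum_mul, trace_sum, trace_sum]
  refine Finset.sum_congr rfl fun k _ => ?_
  rw [← Matrix.mul_assoc, Matrix.trace_mul_comm]
  simp only [Matrix.mul_assoc]

lemma trace_schwarz (hTP : ∑ k, (A k)ᴴ * A k = 1) (X : Matrix (Fin d') (Fin d') ℂ)
    {ρ : Matrix (Fin d) (Fin d) ℂ} (hρ : ρ.PosSemidef) :
    ((ρ * (Phi A X * (Phi A X)ᴴ)).trace).re
      ≤ (((∑ k, A k * ρ * (A k)ᴴ) * (X * Xᴴ)).trace).re := by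
  rw [← trace_Phi, ← sub_nonneg, ← Complex.sub_re, ← trace_sub, ← Matrix.mul_sub, schwarz A hTP,
    Finset.mul_sum, trace_sum, Complex.re_sum]
  refine Finset.sum_nonneg fun k _ => ?_
  rw [← Matrix.mul_assoc, Matrix.trace_mul_comm, ← Matrix.mul_assoc]
  have := (hρ.mul_mul_conjTranspose_same (Xᴴ * A k - A k * (Phi A X)ᴴ)).trace_nonneg
  exact (Complex.le_def.mp this).1

lemma Q_mono (hTP : ∑ k, (A k)ᴴ * A k = 1) (X : Matrix (Fin d') (Fin d') ℂ)
    {ρ σ : Matrix (Fin d) (Fin d) ℂ} (hρ : ρ.PosSemidef) (hσ : σ.PosSemidef) (t : ℝ)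
    (ht : 0 < t) :
    Q ρ σ t (Phi A X) ≤ Q (∑ k, A k * ρ * (A k)ᴴ) (∑ k, A k * σ * (A k)ᴴ) t X := by
  have h1 := trace_schwarz A hTP X hσ
  have h2 := trace_schwarz A hTP (1 - X)ᴴ hρ
  have e : Phi A (1 - X) = 1 - Phi A X := by
    simp only [Phi, Matrix.mul_sub, Matrix.sub_mul, Matrix.mul_one, Finset.sum_sub_distrib, hTP]
  rw [← Phi_conj, e, conjTranspose_conjTranspose, conjTranspose_conjTranspose] at h2
  unfold Q
  gcongr

end channel

/-- Eigenvector unitary and spectral decomposition of a positive semidefinite matrix. -/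
lemma spec {ρ : Matrix n n ℂ} (hρ : ρ.PosSemidef) :
    ∃ (V : Matrix n n ℂ) (p : n → ℝ), V * Vᴴ = 1 ∧ (∀ i, 0 ≤ p i) ∧
      ρ = V * diagonal (fun i => (p i : ℂ)) * Vᴴ ∧
      ∀ t, mpow ρ t = V * diagonal (fun i => ((p i ^ t : ℝ) : ℂ)) * Vᴴ := by
  refine ⟨hρ.1.eigenvectorUnitary, hρ.1.eigenvalues, ?_, hρ.eigenvalues_nonneg, ?_, ?_⟩
  · exact (Unitary.mem_iff.mp hρ.1.eigenvectorUnitary.2).2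
  · exact hρ.1.spectral_theorem
  · intro t
    rw [mpow, dif_pos hρ.1]
    rfl

lemma mpow_one {ρ : Matrix n n ℂ} (hρ : ρ.PosSemidef) : mpow ρ 1 = ρ := by
  obtain ⟨V, p, -, -, h, h'⟩ := spec hρ
  rw [h' 1]
  simp only [Real.rpow_one]
  exact h.symm

lemma mpow_zero {ρ : Matrix n n ℂ} (hρ : ρ.PosSemidef) : mpow ρ 0 = 1 := by
  obtain ⟨V, p, hV, -, -, h'⟩ := spec hρ
  rw [h' 0]
  simpa using hV

lemma scalar_int (p q s : ℝ) (hp : 0 ≤ p) (hq : 0 ≤ q) (hs : s ∈ Set.Ioo (0 : ℝ) 1) :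
    IntegrableOn (fun t => t ^ (s - 2) * (t * p * q / (t * p + q))) (Set.Ioi 0) ∧
    ∫ t in Set.Ioi 0, t ^ (s - 2) * (t * p * q / (t * p + q))
      = q ^ s * p ^ (1 - s) * ∫ t in Set.Ioi 0, Real.rpowIntegrand₀₁ s t 1 := by
  rcases hp.eq_or_lt with rfl | hp'
  · have : (1 - s) ≠ 0 := by have := hs.2; intro h; linarith
    simp [Real.zero_rpow this]
  have hx : 0 ≤ q / p := by positivity
  have hEq : Set.EqOn (fun t => p * Real.rpowIntegrand₀₁ s t (q / p))
      (fun t => t ^ (s - 2) * (t * p * q / (t * p + q))) (Set.Ioi 0) := by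
    intro t ht
    have ht : 0 < t := ht
    have hd : 0 < t * p + q := by positivity
    have hd' : 0 < t + q / p := by positivity
    have e : t ^ (s - 1) = t ^ (s - 2) * t := by
      rw [← Real.rpow_add_one ht.ne']; congr 1; ring
    simp only
    rw [Real.rpowIntegrand₀₁_eq_pow_div hs ht.le hx, e]
    have : t + q / p = (t * p + q) / p := by field_simp
    rw [this]
    field_simp
  constructor
  · exact (integrableOn_congr_fun hEq measurableSet_Ioi).mp
      ((Real.integrableOn_rpowIntegrand₀₁_Ioi hs hx).const_mul p)
  · rw [← setIntegral_congr_fun measurableSet_Ioi hEq, integral_const_mul,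
      Real.integral_rpowIntegrand₀₁_eq_rpow_mul_const hs hx, Real.div_rpow hq hp,
      Real.rpow_sub hp', Real.rpow_one]
    ring

lemma F_int (W V : Matrix n n ℂ) (p q : n → ℝ) (s : ℝ)
    (hp : ∀ i, 0 ≤ p i) (hq : ∀ i, 0 ≤ q i) (hs : s ∈ Set.Ioo (0 : ℝ) 1) :
    IntegrableOn (fun t => t ^ (s - 2) * F W V p q t) (Set.Ioi 0) ∧
    ∫ t in Set.Ioi 0, t ^ (s - 2) * F W V p q t
      = ((V * diagonal (fun i => ((p i ^ (1 - s) : ℝ) : ℂ)) * Vᴴ *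
          (W * diagonal (fun i => ((q i ^ s : ℝ) : ℂ)) * Wᴴ)).trace).re
        * ∫ t in Set.Ioi 0, Real.rpowIntegrand₀₁ s t 1 := by
  have hF : (fun t => t ^ (s - 2) * F W V p q t) = fun t => ∑ j, ∑ i,
      t ^ (s - 2) * (t * p i * q j / (t * p i + q j)) * Complex.normSq ((Wᴴ * V) j i) := by
    funext t
    simp only [F, Finset.mul_sum, mul_assoc]
  have hI : ∀ j i, IntegrableOn (fun t => t ^ (s - 2) * (t * p i * q j / (t * p i + q j))
      * Complex.normSq ((Wᴴ * V) j i)) (Set.Ioi 0) := fun j i =>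
    (scalar_int _ _ s (hp i) (hq j) hs).1.mul_const _
  rw [hF]
  refine ⟨integrable_finset_sum _ fun j _ => integrable_finset_sum _ fun i _ => hI j i, ?_⟩
  rw [integral_finset_sum _ fun j _ => integrable_finset_sum _ fun i _ => hI j i]
  have hm := master W V 1 (fun j => q j ^ s) (fun i => p i ^ (1 - s))
  rw [conjTranspose_one, Matrix.mul_one, Matrix.mul_one, Matrix.mul_one,
    Matrix.trace_mul_comm] at hm
  rw [hm, Finset.sum_mul]
  refine Finset.sum_congr rfl fun j _ => ?_
  rw [integral_finset_sum _ fun i _ => hI j i, Finset.sum_mul]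
  refine Finset.sum_congr rfl fun i _ => ?_
  rw [integral_mul_const, (scalar_int _ _ s (hp i) (hq j) hs).2]
  ring

end RenyiAux

/-- Monotonicity of the Rényi-type trace functional under quantum channels: for density
operators `ρ, σ` and a trace-preserving completely positive map `𝓔` given by Kraus
operators `A k` (trace preservation being `Σ_k Aₖ* Aₖ = 1`), for every `0 ≤ s ≤ 1`,
`Tr[ρ^{1−s} σ^{s}] ≤ Tr[𝓔(ρ)^{1−s} 𝓔(σ)^{s}]`. -/
theorem renyi_trace_monotone {d d' m : ℕ} (ρ σ : Matrix (Fin d) (Fin d) ℂ)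
    (hρ : ρ.PosSemidef) (hρ1 : ρ.trace = 1)
    (hσ : σ.PosSemidef) (hσ1 : σ.trace = 1)
    (A : Fin m → Matrix (Fin d') (Fin d) ℂ)
    (hTP : ∑ k, (A k)ᴴ * A k = 1)
    (E : Matrix (Fin d) (Fin d) ℂ → Matrix (Fin d') (Fin d') ℂ)
    (hE : ∀ X, E X = ∑ k, A k * X * (A k)ᴴ)
    (s : ℝ) (hs0 : 0 ≤ s) (hs1 : s ≤ 1) :
    (((mpow ρ (1 - s)) * (mpow σ s)).trace).re
      ≤ (((mpow (E ρ) (1 - s)) * (mpow (E σ) s)).trace).re := by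
  have hEP : ∀ {X : Matrix (Fin d) (Fin d) ℂ}, X.PosSemidef → (E X).PosSemidef := by
    intro X hX
    rw [hE]
    exact Matrix.posSemidef_sum _ fun k _ => hX.mul_mul_conjTranspose_same _
  have hEtr : ∀ X, (E X).trace = X.trace := by
    intro X
    have h := RenyiAux.trace_Phi A X 1
    rw [Matrix.mul_one, ← hE] at h
    rw [← h]
    simp [RenyiAux.Phi, hTP]
  have hEρ := hEP hρ
  have hEσ := hEP hσ
  rcases hs0.eq_or_lt with rfl | hs0'
  · rw [sub_zero, RenyiAux.mpow_one hρ, RenyiAux.mpow_one hEρ, RenyiAux.mpow_zero hσ,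
      RenyiAux.mpow_zero hEσ, Matrix.mul_one, Matrix.mul_one, hEtr]
  rcases hs1.eq_or_lt with rfl | hs1'
  · rw [sub_self, RenyiAux.mpow_one hσ, RenyiAux.mpow_one hEσ, RenyiAux.mpow_zero hρ,
      RenyiAux.mpow_zero hEρ, Matrix.one_mul, Matrix.one_mul, hEtr]
  have hs : s ∈ Set.Ioo (0 : ℝ) 1 := ⟨hs0', hs1'⟩
  obtain ⟨V, p, hV, hp, hρe, hρp⟩ := RenyiAux.spec hρ
  obtain ⟨W, q, hW, hq, hσe, hσp⟩ := RenyiAux.spec hσ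
  obtain ⟨V', p', hV', hp', hρe', hρp'⟩ := RenyiAux.spec hEρ
  obtain ⟨W', q', hW', hq', hσe', hσp'⟩ := RenyiAux.spec hEσ
  rw [hρp, hσp, hρp', hσp']
  obtain ⟨i1, e1⟩ := RenyiAux.F_int W V p q s hp hq hs
  obtain ⟨i2, e2⟩ := RenyiAux.F_int W' V' p' q' s hp' hq' hs
  refine le_of_mul_le_mul_right ?_ (Real.integral_rpowIntegrand₀₁_one_pos hs)
  rw [← e1, ← e2]
  refine MeasureTheory.setIntegral_mono_on i1 i2 measurableSet_Ioi fun t ht => ?_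
  have ht : 0 < t := ht
  refine mul_le_mul_of_nonneg_left ?_ (Real.rpow_nonneg ht.le _)
  obtain ⟨X, hX⟩ := RenyiAux.F_eq W' V' hW' hV' p' q' hp' hq' t ht
  have h1 := RenyiAux.F_le W V (RenyiAux.Phi A X) hW hV p q hp hq t ht
  rw [← hρe, ← hσe] at h1
  have h2 := RenyiAux.Q_mono A hTP X hρ hσ t ht
  rw [← hE, ← hE] at h2
  rw [← hρe', ← hσe'] at hX
  rw [hX]
  exact h1.trans h2
end
end
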